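/- arXiv:0812.1685 — 2 statements merged into one kernel-verified Lean document; each statement's English description precedes it below -/
import Mathlib

section
/- Let G act weakly on a k-coalgebra C via coalgebra maps λ_α : C → C, and let f be a factor set (i.e. all f_{α,β} are convolution invertible, λ_e(c) = f_{e,e}(c_{(1)}) c_{(2)} g_{e,e}(c_{(3)}), and (CU), (C), (TC) hold), so that C ⋊_f k⟨G⟩ is a G-coalgebra. Then there exist coalgebra maps λ'_α : C → C and a normalized factor set f' (meaning f'_{α,e} = f'_{e,α} = ε_C for all α ∈ G, and in particular λ'_e = id_C) such that C ⋊_f k⟨G⟩ ≅ C ⋊_{f'} k⟨G⟩ as G-coalgebras. Explicitly one may take λ'_e = id, λ'_α = λ_α for α ≠ e, f'_{α,e} = f'_{e,α} = ε_C, f'_{α,α⁻¹} = f_{α,α⁻¹} * f_{e,e} for α ≠ e, and f'_{α,β} = f_{α,β} when α ≠ e, β ≠ e and αβ ≠ e. -/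
open TensorProduct

universe u

/-- A `G`-group coalgebra over `k`: a family of `k`-vector spaces `C α` with
comultiplications `Δ_{α,β} : C (α*β) → C α ⊗ C β` and a counit `ε : C 1 → k`.
The comultiplication takes an explicit proof `γ = α * β` to avoid dependent casts. -/
structure GCoalgebra (k : Type u) [Field k] (G : Type u) [Group G] where
  C : G → Type u
  [acg : ∀ α, AddCommGroup (C α)]
  [mod : ∀ α, Module k (C α)]
  Δ : ∀ ⦃γ⦄ (α β : G), γ = α * β → (C γ →ₗ[k] C α ⊗[k] C β)
  ε : C 1 →ₗ[k] k
  coassoc : ∀ ⦃δ δ₁ δ₂ : G⦄ (α β γ : G) (h₁ : δ = δ₁ * γ) (h₁' : δ₁ = α * β)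
      (h₂ : δ = α * δ₂) (h₂' : δ₂ = β * γ),
      (TensorProduct.assoc k (C α) (C β) (C γ)).toLinearMap ∘ₗ
        (TensorProduct.map (Δ α β h₁') LinearMap.id) ∘ₗ Δ δ₁ γ h₁
      = (TensorProduct.map LinearMap.id (Δ β γ h₂')) ∘ₗ Δ α δ₂ h₂
  counit_right : ∀ (α : G) (h : α = α * 1),
      (TensorProduct.rid k (C α)).toLinearMap ∘ₗ
        (TensorProduct.map LinearMap.id ε) ∘ₗ Δ α 1 h = LinearMap.id
  counit_left : ∀ (α : G) (h : α = 1 * α),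
      (TensorProduct.lid k (C α)).toLinearMap ∘ₗ
        (TensorProduct.map ε LinearMap.id) ∘ₗ Δ 1 α h = LinearMap.id

attribute [instance] GCoalgebra.acg GCoalgebra.mod

variable {k : Type u} [Field k] {G : Type u} [Group G]

/-- A right `G`-`C̲`-comodule. -/
structure GComodule (Cc : GCoalgebra k G) where
  M : G → Type u
  [acg : ∀ α, AddCommGroup (M α)]
  [mod : ∀ α, Module k (M α)]
  ρ : ∀ ⦃γ⦄ (α β : G), γ = α * β → (M γ →ₗ[k] M α ⊗[k] Cc.C β)
  counit : ∀ (α : G) (h : α = α * 1),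
      (TensorProduct.rid k (M α)).toLinearMap ∘ₗ
        (TensorProduct.map LinearMap.id Cc.ε) ∘ₗ ρ α 1 h = LinearMap.id
  coassoc : ∀ ⦃δ δ₁ δ₂ : G⦄ (α β γ : G) (h₁ : δ = δ₁ * γ) (h₁' : δ₁ = α * β)
      (h₂ : δ = α * δ₂) (h₂' : δ₂ = β * γ),
      (TensorProduct.assoc k (M α) (Cc.C β) (Cc.C γ)).toLinearMap ∘ₗ
        (TensorProduct.map (ρ α β h₁') LinearMap.id) ∘ₗ ρ δ₁ γ h₁
      = (TensorProduct.map LinearMap.id (Cc.Δ β γ h₂')) ∘ₗ ρ α δ₂ h₂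

attribute [instance] GComodule.acg GComodule.mod

/-- A morphism of right `G`-`C̲`-comodules. -/
structure GComodHom {Cc : GCoalgebra k G} (M N : GComodule Cc) where
  φ : ∀ α, M.M α →ₗ[k] N.M α
  colinear : ∀ ⦃γ⦄ (α β : G) (h : γ = α * β),
      (TensorProduct.map (φ α) LinearMap.id) ∘ₗ M.ρ α β h = N.ρ α β h ∘ₗ φ γ

/-- A `G`-coalgebra is strong if all comultiplication maps are injective. -/
def GCoalgebra.Strong (Cc : GCoalgebra k G) : Prop :=
  ∀ (α β : G), Function.Injective (Cc.Δ α β rfl)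
section Convolution

variable (k : Type u) [Field k] (C : Type u) [AddCommGroup C] [Module k C]
  [Coalgebra k C]

/-- Convolution of two functionals on a coalgebra: `(f * g)(c) = f(c₁) g(c₂)`. -/
noncomputable def convF (f g : C →ₗ[k] k) : C →ₗ[k] k :=
  LinearMap.mul' k k ∘ₗ TensorProduct.map f g ∘ₗ Coalgebra.comul

/-- `convFM f T : c ↦ f(c₁) T(c₂)`. -/
noncomputable def convFM (f : C →ₗ[k] k) (T : C →ₗ[k] C) : C →ₗ[k] C :=
  (TensorProduct.lid k C).toLinearMap ∘ₗ TensorProduct.map f T ∘ₗ Coalgebra.comul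

/-- `convMF T f : c ↦ T(c₁) f(c₂)`. -/
noncomputable def convMF (T : C →ₗ[k] C) (f : C →ₗ[k] k) : C →ₗ[k] C :=
  (TensorProduct.rid k C).toLinearMap ∘ₗ TensorProduct.map T f ∘ₗ Coalgebra.comul

end Convolution

/-- The data of a crossed coproduct: a `k`-coalgebra `C`, a family of coalgebra
endomorphisms `λ_α` of `C` (a weak `G`-action), and families of functionals
`f_{α,β}, g_{α,β} ∈ C*` (`g` recording the convolution inverses of `f`). -/
structure CrossedData (k G : Type u) [Field k] [Group G] where
  C : Type u
  [acg : AddCommGroup C]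
  [mod : Module k C]
  [coalg : Coalgebra k C]
  lam : G → (C →ₗc[k] C)
  f : G → G → (C →ₗ[k] k)
  g : G → G → (C →ₗ[k] k)

attribute [instance] CrossedData.acg CrossedData.mod CrossedData.coalg

namespace CrossedData

variable {k G : Type u} [Field k] [Group G] (D : CrossedData k G)

/-- `f_{e,e}` and `g_{e,e}` are convolution inverse to each other, and
`λ_e(c) = f_{e,e}(c₁) c₂ g_{e,e}(c₃)`. -/
def IsWeakData : Prop :=
  convF k D.C (D.f 1 1) (D.g 1 1) = Coalgebra.counit ∧
  convF k D.C (D.g 1 1) (D.f 1 1) = Coalgebra.counit ∧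
  (D.lam 1).toLinearMap =
    convMF k D.C (convFM k D.C (D.f 1 1) LinearMap.id) (D.g 1 1)

/-- Condition (CU): `f_{e,α} = f_{e,e}` and `f_{α,e} = f_{e,e} ∘ λ_α`. -/
def CondCU : Prop :=
  ∀ α : G, D.f 1 α = D.f 1 1 ∧ D.f α 1 = D.f 1 1 ∘ₗ (D.lam α).toLinearMap

/-- Condition (C), the cocycle condition:
`f_{β,γ}(λ_α(c₁)) f_{α,βγ}(c₂) = f_{α,β}(c₁) f_{αβ,γ}(c₂)`. -/
def CondC : Prop :=
  ∀ α β γ : G,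
    convF k D.C (D.f β γ ∘ₗ (D.lam α).toLinearMap) (D.f α (β * γ)) =
      convF k D.C (D.f α β) (D.f (α * β) γ)

/-- Condition (TC), the twisted-commutation condition:
`λ_β(λ_α(c₁)) f_{α,β}(c₂) = f_{α,β}(c₁) λ_{αβ}(c₂)`. -/
def CondTC : Prop :=
  ∀ α β : G,
    convMF k D.C ((D.lam β).toLinearMap ∘ₗ (D.lam α).toLinearMap) (D.f α β) =
      convFM k D.C (D.f α β) (D.lam (α * β)).toLinearMap

/-- `f` is a factor set: all `f_{α,β}` are convolution invertible (with inverses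
`g_{α,β}`) and the conditions of Proposition 3.1 hold. -/
def IsFactorSet : Prop :=
  D.IsWeakData ∧
  (∀ α β : G, convF k D.C (D.f α β) (D.g α β) = Coalgebra.counit ∧
    convF k D.C (D.g α β) (D.f α β) = Coalgebra.counit) ∧
  D.CondCU ∧ D.CondC ∧ D.CondTC

/-- `f` is normalized: `f_{α,e} = f_{e,α} = ε_C`. -/
def Normalized : Prop :=
  ∀ α : G, D.f α 1 = Coalgebra.counit ∧ D.f 1 α = Coalgebra.counit

/-- The comultiplication `δ_{α,β} : C → C ⊗ C` of the crossed coproduct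
`C ⋊_f k⟨G⟩` (identifying `C ⋊ p_α` with `C`):
`δ_{α,β}(c) = c₁ ⊗ λ_α(c₂) f_{α,β}(c₃)`. -/
noncomputable def delta (α β : G) : D.C →ₗ[k] D.C ⊗[k] D.C :=
  TensorProduct.map LinearMap.id
      (convMF k D.C (D.lam α).toLinearMap (D.f α β)) ∘ₗ Coalgebra.comul

/-- The `G`-coalgebra axioms for the (constant) family `C ⋊ p_α ≅ C` with the
crossed-coproduct structure maps `δ_{α,β}` and counit `g_{e,e}`. -/
def IsGCoalgebra : Prop :=
  (∀ α β γ : G,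
    (TensorProduct.assoc k D.C D.C D.C).toLinearMap ∘ₗ
      (TensorProduct.map (D.delta α β) LinearMap.id) ∘ₗ D.delta (α * β) γ
    = (TensorProduct.map LinearMap.id (D.delta β γ)) ∘ₗ D.delta α (β * γ)) ∧
  (∀ α : G,
    (TensorProduct.rid k D.C).toLinearMap ∘ₗ
      (TensorProduct.map LinearMap.id (D.g 1 1)) ∘ₗ D.delta α 1 = LinearMap.id) ∧
  (∀ α : G,
    (TensorProduct.lid k D.C).toLinearMap ∘ₗ
      (TensorProduct.map (D.g 1 1) LinearMap.id) ∘ₗ D.delta 1 α = LinearMap.id)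

end CrossedData
/-- Two crossed coproducts are isomorphic as `G`-coalgebras: there is a family of
bijective `k`-linear maps intertwining the comultiplications and counits. -/
noncomputable def CrossedIso {k G : Type u} [Field k] [Group G]
    (D D' : CrossedData k G) : Prop :=
  ∃ φ : ∀ _ : G, D.C ≃ₗ[k] D'.C,
    (D'.g 1 1 ∘ₗ (φ 1).toLinearMap = D.g 1 1) ∧
    ∀ α β : G,
      TensorProduct.map (φ α).toLinearMap (φ β).toLinearMap ∘ₗ D.delta α β
        = D'.delta α β ∘ₗ (φ (α * β)).toLinearMap
/-- The normalization of a factor set: `λ'_e = id`, `λ'_α = λ_α` for `α ≠ e`,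
`f'_{α,e} = f'_{e,α} = ε_C`, `f'_{α,α⁻¹} = f_{α,α⁻¹} * f_{e,e}` for `α ≠ e`, and
`f'_{α,β} = f_{α,β}` otherwise. -/
noncomputable def CrossedData.normalize {k G : Type u} [Field k] [Group G]
    [DecidableEq G] (D : CrossedData k G) : CrossedData k G where
  C := D.C
  lam α := if α = 1 then CoalgHom.id k D.C else D.lam α
  f α β :=
    if α = 1 then Coalgebra.counit
    else if β = 1 then Coalgebra.counit
    else if α * β = 1 then convF k D.C (D.f α β) (D.f 1 1)
    else D.f α β
  g α β :=
    if α = 1 then Coalgebra.counit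
    else if β = 1 then Coalgebra.counit
    else if α * β = 1 then convF k D.C (D.g 1 1) (D.g α β)
    else D.g α β

section ConvolutionLemmas

variable {k : Type u} [Field k] {C : Type u} [AddCommGroup C] [Module k C] [Coalgebra k C]

lemma LinearMap.eq_of_forall_dual_comp_eq {V W : Type*} [AddCommGroup V] [Module k V]
    [AddCommGroup W] [Module k W] {S T : V →ₗ[k] W}
    (h : ∀ p : W →ₗ[k] k, p ∘ₗ S = p ∘ₗ T) : S = T := by
  ext c
  rw [← sub_eq_zero, ← Module.forall_dual_apply_eq_zero_iff k]
  intro p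
  rw [map_sub, sub_eq_zero]
  exact LinearMap.congr_fun (h p) c

lemma toConv_convF (f g : C →ₗ[k] k) :
    WithConv.toConv (convF k C f g) = WithConv.toConv f * WithConv.toConv g := rfl

lemma toConv_counit :
    WithConv.toConv (Coalgebra.counit : C →ₗ[k] k) = 1 := rfl

lemma comp_convMF (p : C →ₗ[k] k) (T : C →ₗ[k] C) (f : C →ₗ[k] k) :
    p ∘ₗ convMF k C T f = convF k C (p ∘ₗ T) f := by
  have h : p ∘ₗ (TensorProduct.rid k C).toLinearMap ∘ₗ TensorProduct.map T f =
      LinearMap.mul' k k ∘ₗ TensorProduct.map (p ∘ₗ T) f :=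
    TensorProduct.ext' fun x y => by simp [mul_comm]
  exact congrArg (· ∘ₗ Coalgebra.comul) h

lemma comp_convFM (p : C →ₗ[k] k) (T : C →ₗ[k] C) (f : C →ₗ[k] k) :
    p ∘ₗ convFM k C f T = convF k C f (p ∘ₗ T) := by
  have h : p ∘ₗ (TensorProduct.lid k C).toLinearMap ∘ₗ TensorProduct.map f T =
      LinearMap.mul' k k ∘ₗ TensorProduct.map f (p ∘ₗ T) :=
    TensorProduct.ext' fun x y => by simp
  exact congrArg (· ∘ₗ Coalgebra.comul) h

lemma map_id_comp_comul_comp_convMF (S : C →ₗ[k] C) (v : C →ₗ[k] k) :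
    TensorProduct.map LinearMap.id S ∘ₗ Coalgebra.comul ∘ₗ convMF k C LinearMap.id v =
      TensorProduct.map LinearMap.id (convMF k C S v) ∘ₗ Coalgebra.comul := by
  have h : TensorProduct.map LinearMap.id S ∘ₗ Coalgebra.comul ∘ₗ
        (TensorProduct.rid k C).toLinearMap ∘ₗ TensorProduct.map LinearMap.id v =
      TensorProduct.map LinearMap.id
          ((TensorProduct.rid k C).toLinearMap ∘ₗ TensorProduct.map S v) ∘ₗ
        (TensorProduct.assoc k C C C).toLinearMap ∘ₗ Coalgebra.comul.rTensor C := by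
    refine TensorProduct.ext' fun x y => ?_
    simp only [LinearMap.comp_apply, TensorProduct.map_tmul, LinearEquiv.coe_coe,
      TensorProduct.rid_tmul, map_smul, LinearMap.id_apply, LinearMap.rTensor_tmul]
    induction Coalgebra.comul (R := k) x using TensorProduct.induction_on with
    | zero => simp
    | tmul a b => simp
    | add a b ha hb => simp only [map_add, smul_add, ha, hb, TensorProduct.add_tmul]
  calc _ = TensorProduct.map LinearMap.id
          ((TensorProduct.rid k C).toLinearMap ∘ₗ TensorProduct.map S v) ∘ₗ
        ((TensorProduct.assoc k C C C).toLinearMap ∘ₗ Coalgebra.comul.rTensor C ∘ₗ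
          Coalgebra.comul) := congrArg (· ∘ₗ Coalgebra.comul) h
    _ = _ := by
      rw [Coalgebra.coassoc, LinearMap.lTensor, ← LinearMap.comp_assoc, ← TensorProduct.map_comp]
      rfl

lemma map_convMF_comp_comul (S : C →ₗ[k] C) (v : C →ₗ[k] k) :
    TensorProduct.map (convMF k C LinearMap.id v) S ∘ₗ Coalgebra.comul =
      TensorProduct.map LinearMap.id (convFM k C v S) ∘ₗ Coalgebra.comul := by
  have h : TensorProduct.map ((TensorProduct.rid k C).toLinearMap ∘ₗ
        TensorProduct.map LinearMap.id v) S =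
      TensorProduct.map LinearMap.id
          ((TensorProduct.lid k C).toLinearMap ∘ₗ TensorProduct.map v S) ∘ₗ
        (TensorProduct.assoc k C C C).toLinearMap :=
    TensorProduct.ext_threefold fun x y z => by simp [TensorProduct.smul_tmul]
  calc _ = TensorProduct.map ((TensorProduct.rid k C).toLinearMap ∘ₗ
        TensorProduct.map LinearMap.id v) S ∘ₗ Coalgebra.comul.rTensor C ∘ₗ
          Coalgebra.comul := by
        rw [LinearMap.rTensor, ← LinearMap.comp_assoc, ← TensorProduct.map_comp]
        rfl
    _ = TensorProduct.map LinearMap.id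
          ((TensorProduct.lid k C).toLinearMap ∘ₗ TensorProduct.map v S) ∘ₗ
        ((TensorProduct.assoc k C C C).toLinearMap ∘ₗ Coalgebra.comul.rTensor C ∘ₗ
          Coalgebra.comul) := by rw [h]; rfl
    _ = _ := by
      rw [Coalgebra.coassoc, LinearMap.lTensor, ← LinearMap.comp_assoc, ← TensorProduct.map_comp]
      rfl

lemma convMF_id_comp_convMF_id {u v : C →ₗ[k] k} (h : convF k C u v = Coalgebra.counit) :
    convMF k C LinearMap.id u ∘ₗ convMF k C LinearMap.id v = LinearMap.id := by
  have huv : WithConv.toConv u * WithConv.toConv v = 1 := congrArg WithConv.toConv h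
  refine LinearMap.eq_of_forall_dual_comp_eq fun p => WithConv.toConv_injective ?_
  rw [← LinearMap.comp_assoc, comp_convMF, comp_convMF, LinearMap.comp_id, toConv_convF,
    toConv_convF, mul_assoc, huv, mul_one]

/-- The linear automorphism `c ↦ c₁ v(c₂)` of a coalgebra given by a convolution
invertible functional `v` with inverse `u`. -/
noncomputable def convEquiv (u v : C →ₗ[k] k) (huv : convF k C u v = Coalgebra.counit)
    (hvu : convF k C v u = Coalgebra.counit) : C ≃ₗ[k] C :=
  LinearEquiv.ofLinearMap (convMF k C LinearMap.id v) (convMF k C LinearMap.id u)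
    (convMF_id_comp_convMF_id hvu) (convMF_id_comp_convMF_id huv)

/-- Precomposition with a coalgebra endomorphism, as an endomorphism of the convolution
monoid of functionals. -/
def convPrecomp (l : C →ₗc[k] C) : WithConv (C →ₗ[k] k) →* WithConv (C →ₗ[k] k) where
  toFun x := WithConv.toConv (x.ofConv ∘ₗ l.toLinearMap)
  map_one' := WithConv.ofConv_injective <| by
    change Coalgebra.counit ∘ₗ l.toLinearMap = Coalgebra.counit
    exact l.counit_comp
  map_mul' x y := WithConv.ofConv_injective (LinearMap.convMul_comp_coalgHom_distrib x y l)

end ConvolutionLemmas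

/-- The identities dual to those of a factor set: a crossed system of `G` over a monoid `A`,
with `g` recording the inverses of the cocycle `f`. -/
structure IsCrossedSystem {G A : Type*} [Group G] [Monoid A] (s : G → A →* A)
    (f g : G → G → A) : Prop where
  mul_inv : ∀ α β, f α β * g α β = 1
  inv_mul : ∀ α β, g α β * f α β = 1
  map_one : ∀ x, s 1 x = f 1 1 * x * g 1 1
  one_left : ∀ α, f 1 α = f 1 1
  one_right : ∀ α, f α 1 = s α (f 1 1)
  cocycle : ∀ α β γ, s α (f β γ) * f α (β * γ) = f α β * f (α * β) γ
  twisted : ∀ α β x, s α (s β x) * f α β = f α β * s (α * β) x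

section Gauge

variable {G A : Type*} [Group G] [Monoid A] {s s' : G → A →* A} {f f' : G → G → A} {u v : G → A}

/-- `(s', f')` is obtained from `(s, f)` by the change of basis `u` with inverse `v`. -/
structure IsGauge (s s' : G → A →* A) (f f' : G → G → A) (u v : G → A) : Prop where
  mul_inv : ∀ α, u α * v α = 1
  inv_mul : ∀ α, v α * u α = 1
  map_eq : ∀ α x, s' α x = v α * s α x * u α
  cocycle_eq : ∀ α β, f' α β = v α * s α (v β) * f α β * u (α * β)

namespace IsGauge

variable (h : IsGauge s s' f f' u v)
include h

lemma mul_inv_assoc (α : G) (x : A) : u α * (v α * x) = x := by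
  rw [← mul_assoc, h.mul_inv, one_mul]

lemma map_mul_inv_assoc (α β : G) (x : A) : s α (u β) * (s α (v β) * x) = x := by
  rw [← mul_assoc, ← map_mul, h.mul_inv, map_one, one_mul]

lemma twisted (ht : ∀ α β x, s α (s β x) * f α β = f α β * s (α * β) x) (α β : G) (x : A) :
    s' α (s' β x) * f' α β = f' α β * s' (α * β) x := by
  have ht' (y : A) : s α (s β x) * (f α β * y) = f α β * (s (α * β) x * y) := by
    rw [← mul_assoc, ht, mul_assoc]
  simp only [h.map_eq, h.cocycle_eq, map_mul, mul_assoc, h.mul_inv_assoc, h.map_mul_inv_assoc,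
    ht']

lemma cocycle (ht : ∀ α β x, s α (s β x) * f α β = f α β * s (α * β) x)
    (hc : ∀ α β γ, s α (f β γ) * f α (β * γ) = f α β * f (α * β) γ) (α β γ : G) :
    s' α (f' β γ) * f' α (β * γ) = f' α β * f' (α * β) γ := by
  have hc' (y : A) : s α (f β γ) * (f α (β * γ) * y) = f α β * (f (α * β) γ * y) := by
    rw [← mul_assoc, hc, mul_assoc]
  have ht' (x y : A) : s α (s β x) * (f α β * y) = f α β * (s (α * β) x * y) := by
    rw [← mul_assoc, ht, mul_assoc]
  simp only [h.map_eq, h.cocycle_eq, map_mul, mul_assoc, h.mul_inv_assoc, h.map_mul_inv_assoc,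
    hc', ht']

lemma intertwines (α β : G) (x : A) :
    v α * (s α (x * v β) * f α β) = s' α x * f' α β * v (α * β) := by
  simp only [h.map_eq, h.cocycle_eq, map_mul, mul_assoc, h.mul_inv_assoc, h.mul_inv, mul_one]

end IsGauge

end Gauge

namespace CrossedData

variable {k G : Type u} [Field k] [Group G] (D : CrossedData k G)

/-- The convolution algebra of functionals on the underlying coalgebra. -/
abbrev ConvDual : Type u := WithConv (D.C →ₗ[k] k)

/-- The functionals `f_{α,β}` as elements of the convolution algebra. -/
def dualF (α β : G) : D.ConvDual := WithConv.toConv (D.f α β)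

/-- The functionals `g_{α,β}` as elements of the convolution algebra. -/
def dualG (α β : G) : D.ConvDual := WithConv.toConv (D.g α β)

/-- The endomorphisms of the convolution algebra dual to the weak action. -/
def dualS (α : G) : D.ConvDual →* D.ConvDual := convPrecomp (D.lam α)

lemma isFactorSet_iff : D.IsFactorSet ↔ IsCrossedSystem D.dualS D.dualF D.dualG := by
  have eq_iff {S T : D.C →ₗ[k] D.C} : S = T ↔ ∀ x : D.ConvDual,
      WithConv.toConv (x.ofConv ∘ₗ S) = WithConv.toConv (x.ofConv ∘ₗ T) :=
    ⟨fun h x => by rw [h], fun h => LinearMap.eq_of_forall_dual_comp_eq fun p =>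
      WithConv.toConv_injective (h (WithConv.toConv p))⟩
  have lam_one_iff : (D.lam 1).toLinearMap =
        convMF k D.C (convFM k D.C (D.f 1 1) LinearMap.id) (D.g 1 1) ↔
      ∀ x, D.dualS 1 x = D.dualF 1 1 * x * D.dualG 1 1 := by
    simp only [eq_iff, comp_convMF, comp_convFM, LinearMap.comp_id]
    rfl
  have twisted_iff : D.CondTC ↔
      ∀ α β x, D.dualS α (D.dualS β x) * D.dualF α β = D.dualF α β * D.dualS (α * β) x := by
    simp only [CondTC, eq_iff, comp_convMF, comp_convFM]
    rfl
  have inj {x y : D.C →ₗ[k] k} (h : WithConv.toConv x = WithConv.toConv y) : x = y :=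
    WithConv.toConv_injective h
  constructor
  · rintro ⟨⟨-, -, h₁⟩, hi, hu, hc, ht⟩
    exact
      { mul_inv := fun α β => congrArg WithConv.toConv (hi α β).1
        inv_mul := fun α β => congrArg WithConv.toConv (hi α β).2
        map_one := lam_one_iff.1 h₁
        one_left := fun α => congrArg WithConv.toConv (hu α).1
        one_right := fun α => congrArg WithConv.toConv (hu α).2
        cocycle := fun α β γ => congrArg WithConv.toConv (hc α β γ)
        twisted := twisted_iff.1 ht }
  · intro h
    exact ⟨⟨inj (h.mul_inv 1 1), inj (h.inv_mul 1 1), lam_one_iff.2 h.map_one⟩,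
      fun α β => ⟨inj (h.mul_inv α β), inj (h.inv_mul α β)⟩,
      fun α => ⟨inj (h.one_left α), inj (h.one_right α)⟩,
      fun α β γ => inj (h.cocycle α β γ), twisted_iff.2 h.twisted⟩

variable [DecidableEq G]

lemma normalize_dualF (α β : G) : (D.normalize.dualF α β : D.ConvDual) =
    if α = 1 then 1 else if β = 1 then 1
    else if α * β = 1 then D.dualF α β * D.dualF 1 1 else D.dualF α β := by
  change WithConv.toConv (if α = 1 then (Coalgebra.counit : D.C →ₗ[k] k)
    else if β = 1 then Coalgebra.counit
    else if α * β = 1 then convF k D.C (D.f α β) (D.f 1 1) else D.f α β) = _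
  split_ifs <;> rfl

lemma normalize_dualG (α β : G) : (D.normalize.dualG α β : D.ConvDual) =
    if α = 1 then 1 else if β = 1 then 1
    else if α * β = 1 then D.dualG 1 1 * D.dualG α β else D.dualG α β := by
  change WithConv.toConv (if α = 1 then (Coalgebra.counit : D.C →ₗ[k] k)
    else if β = 1 then Coalgebra.counit
    else if α * β = 1 then convF k D.C (D.g 1 1) (D.g α β) else D.g α β) = _
  split_ifs <;> rfl

/-- The endomorphisms `D.normalize.dualS`, acting on the convolution algebra of `D`. -/
def normalizeDualS (α : G) : D.ConvDual →* D.ConvDual :=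
  convPrecomp (if α = 1 then CoalgHom.id k D.C else D.lam α)

lemma normalizeDualS_apply (α : G) (x : D.ConvDual) :
    D.normalizeDualS α x = if α = 1 then x else D.dualS α x := by
  rw [normalizeDualS]
  split_ifs <;> rfl

lemma isGauge_normalize (h : IsCrossedSystem D.dualS D.dualF D.dualG) :
    IsGauge (A := D.ConvDual) D.dualS D.normalizeDualS D.dualF D.normalize.dualF
      (fun α => if α = 1 then D.dualF 1 1 else 1)
      (fun α => if α = 1 then D.dualG 1 1 else 1) where
  mul_inv α := by split_ifs <;> simp [h.mul_inv]
  inv_mul α := by split_ifs <;> simp [h.inv_mul]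
  map_eq α x := by
    rw [normalizeDualS_apply]
    split_ifs with hα
    · subst hα
      rw [h.map_one]
      simp only [mul_assoc, h.inv_mul, mul_one]
      rw [← mul_assoc, h.inv_mul, one_mul]
    · simp
  cocycle_eq α β := by
    rw [normalize_dualF]
    by_cases hα : α = 1
    · subst hα
      by_cases hβ : β = 1
      · subst hβ
        simp [h.map_one, mul_assoc, h.inv_mul]
      · simp [hβ, h.one_left β, h.inv_mul]
    · by_cases hβ : β = 1
      · subst hβ
        simp [hα, h.one_right α, ← map_mul, h.inv_mul]
      · by_cases hαβ : α * β = 1 <;> simp [hα, hβ, hαβ]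

lemma isCrossedSystem_normalize (h : IsCrossedSystem D.dualS D.dualF D.dualG) :
    IsCrossedSystem (A := D.ConvDual) D.normalizeDualS D.normalize.dualF D.normalize.dualG where
  mul_inv α β := by
    rw [normalize_dualF, normalize_dualG]
    split_ifs
    · simp
    · simp
    · rw [mul_assoc, ← mul_assoc (D.dualF 1 1), h.mul_inv, one_mul, h.mul_inv]
    · exact h.mul_inv α β
  inv_mul α β := by
    rw [normalize_dualF, normalize_dualG]
    split_ifs
    · simp
    · simp
    · rw [mul_assoc, ← mul_assoc (D.dualG α β), h.inv_mul, one_mul, h.inv_mul]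
    · exact h.inv_mul α β
  map_one x := by simp [normalize_dualF, normalize_dualG, normalizeDualS_apply]
  one_left α := by simp [normalize_dualF]
  one_right α := by simp [normalize_dualF]
  cocycle := (D.isGauge_normalize h).cocycle h.twisted h.cocycle
  twisted := (D.isGauge_normalize h).twisted h.twisted

lemma normalized_normalize : D.normalize.Normalized := fun α =>
  ⟨WithConv.toConv_injective ((D.normalize_dualF α 1).trans (by simp; rfl)),
    WithConv.toConv_injective ((D.normalize_dualF 1 α).trans (by simp; rfl))⟩

end CrossedData

lemma CrossedIso.of_isGauge {k G : Type u} [Field k] [Group G] {D : CrossedData k G}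
    {lam : G → (D.C →ₗc[k] D.C)} {f g : G → G → (D.C →ₗ[k] k)} {u v : G → D.ConvDual}
    (h : IsGauge D.dualS (fun α => convPrecomp (lam α)) D.dualF
      (fun α β => WithConv.toConv (f α β)) u v)
    (hv : v 1 = D.dualG 1 1) (hg : g 1 1 = Coalgebra.counit) :
    CrossedIso D { C := D.C, lam := lam, f := f, g := g } := by
  refine ⟨fun α => convEquiv (u α).ofConv (v α).ofConv
    (WithConv.toConv_injective (h.mul_inv α)) (WithConv.toConv_injective (h.inv_mul α)), ?_, ?_⟩
  · change g 1 1 ∘ₗ convMF k D.C LinearMap.id (v 1).ofConv = D.g 1 1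
    refine WithConv.toConv_injective ?_
    rw [comp_convMF, hg, hv, LinearMap.comp_id, toConv_convF, toConv_counit, one_mul]
    rfl
  · intro α β
    change TensorProduct.map (convMF k D.C LinearMap.id (v α).ofConv)
        (convMF k D.C LinearMap.id (v β).ofConv) ∘ₗ
        TensorProduct.map LinearMap.id (convMF k D.C (D.lam α).toLinearMap (D.f α β)) ∘ₗ
          Coalgebra.comul =
      TensorProduct.map LinearMap.id (convMF k D.C (lam α).toLinearMap (f α β)) ∘ₗ
        Coalgebra.comul ∘ₗ convMF k D.C LinearMap.id (v (α * β)).ofConv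
    rw [← LinearMap.comp_assoc, ← TensorProduct.map_comp, LinearMap.comp_id,
      map_convMF_comp_comul, map_id_comp_comul_comp_convMF]
    congr 2
    refine LinearMap.eq_of_forall_dual_comp_eq fun p => WithConv.toConv_injective ?_
    rw [comp_convFM, comp_convMF, comp_convMF, ← LinearMap.comp_assoc, comp_convMF, comp_convMF,
      LinearMap.comp_id]
    exact h.intertwines α β (WithConv.toConv p)

/-- **Proposition 3.2.** Let `G` act weakly on a coalgebra `C` and let `f` be a factor
set. Then there are coalgebra maps `λ'_α` and a normalized factor set `f'`
(explicitly, the ones of `CrossedData.normalize`) such that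
`C ⋊_f k⟨G⟩ ≅ C ⋊_{f'} k⟨G⟩` as `G`-coalgebras. -/
theorem crossed_coproduct_normalize {k G : Type u} [Field k] [Group G]
    [DecidableEq G] (D : CrossedData k G) (hD : D.IsFactorSet) :
    D.normalize.IsFactorSet ∧ D.normalize.Normalized ∧ CrossedIso D D.normalize := by
  have h := D.isFactorSet_iff.1 hD
  exact ⟨D.normalize.isFactorSet_iff.2 (D.isCrossedSystem_normalize h), D.normalized_normalize,
    CrossedIso.of_isGauge (D.isGauge_normalize h) (by simp) (by simp)⟩
end

section
/- For a G-coalgebra C̲, the following assertions are equivalent: (1) C̲ is isomorphic as a G-coalgebra to a smash coproduct G-coalgebra C ⋊ k⟨G⟩, i.e. a crossed coproduct with f_{α,β} = ε_C for all α,β ∈ G, so Δ_{α,β}(c ⋊ p_{αβ}) = (c_{(1)} ⋊ p_α) ⊗ (λ_α(c_{(2)}) ⋊ p_β); (2) there exists a morphism of G-coalgebras u̲ : C̲ → k⟨G⟩, where k⟨G⟩ is the G-coalgebra with k⟨G⟩_σ = k p_σ, Δ_{σ,τ}(p_{στ}) = p_σ ⊗ p_τ and ε(p_e) = 1. -/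
open TensorProduct

universe u

variable {k : Type u} [Field k] {G : Type u} [Group G]

/-- A `G`-coalgebra `C̲` is cocleft if there is a convolution invertible morphism
`u̲ : C̲ → k⟨G⟩` in `(M_k)^G`, i.e. functionals `u_α ∈ C_α*` and `v_α ∈ C_{α⁻¹}*`
with `u_α(c_{(1,α)}) v_α(c_{(2,α⁻¹)}) = v_α(c_{(1,α⁻¹)}) u_α(c_{(2,α)}) = ε(c)`
for all `c ∈ C_e`. -/
def GCoalgebra.Cocleft {k G : Type u} [Field k] [Group G] (Cc : GCoalgebra k G) : Prop :=
  ∃ (u : ∀ α : G, Cc.C α →ₗ[k] k) (v : ∀ α : G, Cc.C α⁻¹ →ₗ[k] k),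
    ∀ α : G,
      LinearMap.mul' k k ∘ₗ TensorProduct.map (u α) (v α) ∘ₗ
          Cc.Δ α α⁻¹ (mul_inv_cancel α).symm = Cc.ε ∧
      LinearMap.mul' k k ∘ₗ TensorProduct.map (v α) (u α) ∘ₗ
          Cc.Δ α⁻¹ α (inv_mul_cancel α).symm = Cc.ε

/-- `C̲` is isomorphic, as a `G`-coalgebra, to the crossed coproduct `C ⋊_f k⟨G⟩`
determined by the crossed data `D`. -/
def IsoToCrossed {k G : Type u} [Field k] [Group G] (Cc : GCoalgebra k G)
    (D : CrossedData k G) : Prop :=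
  ∃ φ : ∀ α : G, Cc.C α ≃ₗ[k] D.C,
    (D.g 1 1 ∘ₗ (φ 1).toLinearMap = Cc.ε) ∧
    ∀ ⦃γ : G⦄ (α β : G) (h : γ = α * β),
      TensorProduct.map (φ α).toLinearMap (φ β).toLinearMap ∘ₗ Cc.Δ α β h
        = D.delta α β ∘ₗ (φ γ).toLinearMap

/-- `C_α` is isomorphic to `C_e` as a left `C_e`-comodule (left coactions `Δ_{e,α}`
and `Δ_{e,e}`). -/
def LeftCeIso {k G : Type u} [Field k] [Group G] (Cc : GCoalgebra k G) (α : G) : Prop :=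
  ∃ φ : Cc.C α ≃ₗ[k] Cc.C 1,
    Cc.Δ 1 1 (one_mul 1).symm ∘ₗ φ.toLinearMap
      = TensorProduct.map LinearMap.id φ.toLinearMap ∘ₗ Cc.Δ 1 α (one_mul α).symm
section Contraction

variable {k : Type*} [CommSemiring k] {M N P Q : Type*}
  [AddCommMonoid M] [AddCommMonoid N] [AddCommMonoid P] [AddCommMonoid Q]
  [Module k M] [Module k N] [Module k P] [Module k Q]

/-- Contraction of the right tensor factor with a functional: `m ⊗ n ↦ u(n) m`. -/
noncomputable def slantRight (u : N →ₗ[k] k) : M ⊗[k] N →ₗ[k] M :=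
  (TensorProduct.rid k M).toLinearMap ∘ₗ TensorProduct.map LinearMap.id u

/-- Contraction of the left tensor factor with a functional: `m ⊗ n ↦ u(m) n`. -/
noncomputable def slantLeft (u : M →ₗ[k] k) : M ⊗[k] N →ₗ[k] N :=
  (TensorProduct.lid k N).toLinearMap ∘ₗ TensorProduct.map u LinearMap.id

@[simp]
theorem slantRight_tmul (u : N →ₗ[k] k) (m : M) (n : N) :
    slantRight u (m ⊗ₜ[k] n) = u n • m := by
  simp [slantRight]

@[simp]
theorem slantLeft_tmul (u : M →ₗ[k] k) (m : M) (n : N) :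
    slantLeft u (m ⊗ₜ[k] n) = u m • n := by
  simp [slantLeft]

theorem slantRight_map (u : Q →ₗ[k] k) (S : M →ₗ[k] P) (T : N →ₗ[k] Q) (x : M ⊗[k] N) :
    slantRight u (TensorProduct.map S T x) = S (slantRight (u ∘ₗ T) x) := by
  induction x with
  | zero => simp
  | tmul m n => simp
  | add x y hx hy => simp only [map_add, hx, hy]

theorem slantLeft_map (u : P →ₗ[k] k) (S : M →ₗ[k] P) (T : N →ₗ[k] Q) (x : M ⊗[k] N) :
    slantLeft u (TensorProduct.map S T x) = T (slantLeft (u ∘ₗ S) x) := by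
  induction x with
  | zero => simp
  | tmul m n => simp
  | add x y hx hy => simp only [map_add, hx, hy]

theorem apply_slantRight (u : M →ₗ[k] k) (v : N →ₗ[k] k) (x : M ⊗[k] N) :
    u (slantRight v x) = LinearMap.mul' k k (TensorProduct.map u v x) := by
  induction x with
  | zero => simp
  | tmul m n => simp [mul_comm]
  | add x y hx hy => simp only [map_add, hx, hy]

theorem apply_slantLeft (u : M →ₗ[k] k) (v : N →ₗ[k] k) (x : M ⊗[k] N) :
    v (slantLeft u x) = LinearMap.mul' k k (TensorProduct.map u v x) := by
  induction x with
  | zero => simp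
  | tmul m n => simp
  | add x y hx hy => simp only [map_add, hx, hy]

theorem map_slantRight_assoc (u : P →ₗ[k] k) (x : (M ⊗[k] N) ⊗[k] P) :
    TensorProduct.map LinearMap.id (slantRight u) (TensorProduct.assoc k M N P x) =
      slantRight u x := by
  induction x with
  | zero => simp
  | tmul y p =>
    induction y with
    | zero => simp
    | tmul m n => simp
    | add y z hy hz => simp only [TensorProduct.add_tmul, map_add, hy, hz]
  | add x y hx hy => simp only [map_add, hx, hy]

theorem slantLeft_assoc (u : M →ₗ[k] k) (x : (M ⊗[k] N) ⊗[k] P) :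
    slantLeft u (TensorProduct.assoc k M N P x) =
      TensorProduct.map (slantLeft u) LinearMap.id x := by
  induction x with
  | zero => simp
  | tmul y p =>
    induction y with
    | zero => simp
    | tmul m n => simp [TensorProduct.smul_tmul']
    | add y z hy hz => simp only [TensorProduct.add_tmul, map_add, hy, hz]
  | add x y hx hy => simp only [map_add, hx, hy]

theorem map_slantLeft_assoc (u : N →ₗ[k] k) (x : (M ⊗[k] N) ⊗[k] P) :
    TensorProduct.map LinearMap.id (slantLeft u) (TensorProduct.assoc k M N P x) =
      TensorProduct.map (slantRight u) LinearMap.id x := by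
  induction x with
  | zero => simp
  | tmul y p =>
    induction y with
    | zero => simp
    | tmul m n => simp [TensorProduct.smul_tmul']
    | add y z hy hz => simp only [TensorProduct.add_tmul, map_add, hy, hz]
  | add x y hx hy => simp only [map_add, hx, hy]

end Contraction

namespace GCoalgebra

variable {k G : Type u} [Field k] [Group G] (Cc : GCoalgebra k G)

theorem coassoc_apply {δ δ₁ δ₂ : G} (α β γ : G) (h₁ : δ = δ₁ * γ) (h₁' : δ₁ = α * β)
    (h₂ : δ = α * δ₂) (h₂' : δ₂ = β * γ) (c : Cc.C δ) :
    TensorProduct.assoc k (Cc.C α) (Cc.C β) (Cc.C γ)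
        (TensorProduct.map (Cc.Δ α β h₁') LinearMap.id (Cc.Δ δ₁ γ h₁ c)) =
      TensorProduct.map LinearMap.id (Cc.Δ β γ h₂') (Cc.Δ α δ₂ h₂ c) :=
  LinearMap.congr_fun (Cc.coassoc α β γ h₁ h₁' h₂ h₂') c

/-- The family `u` of functionals is a morphism of `G`-coalgebras to `k⟨G⟩`. -/
structure IsCharacter (u : ∀ α : G, Cc.C α →ₗ[k] k) : Prop where
  one : u 1 = Cc.ε
  mul : ∀ ⦃γ : G⦄ (α β : G) (h : γ = α * β),
    LinearMap.mul' k k ∘ₗ TensorProduct.map (u α) (u β) ∘ₗ Cc.Δ α β h = u γ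

variable (u : ∀ α : G, Cc.C α →ₗ[k] k)

/-- The map `C_{αβ} → C_α`, `c ↦ c_{(1,α)} u_β(c_{(2,β)})`. -/
noncomputable def dropRight {γ : G} (α β : G) (h : γ = α * β) : Cc.C γ →ₗ[k] Cc.C α :=
  slantRight (u β) ∘ₗ Cc.Δ α β h

/-- The map `C_{αβ} → C_β`, `c ↦ u_α(c_{(1,α)}) c_{(2,β)}`. -/
noncomputable def dropLeft {γ : G} (α β : G) (h : γ = α * β) : Cc.C γ →ₗ[k] Cc.C β :=
  slantLeft (u α) ∘ₗ Cc.Δ α β h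

theorem comul_dropRight {δ δ₁ δ₂ : G} (α β γ : G) (h₁ : δ = δ₁ * γ) (h₁' : δ₁ = α * β)
    (h₂ : δ = α * δ₂) (h₂' : δ₂ = β * γ) (c : Cc.C δ) :
    Cc.Δ α β h₁' (Cc.dropRight u δ₁ γ h₁ c) =
      TensorProduct.map LinearMap.id (Cc.dropRight u β γ h₂') (Cc.Δ α δ₂ h₂ c) := by
  have h := congrArg (TensorProduct.map LinearMap.id (slantRight (u γ)))
    (Cc.coassoc_apply α β γ h₁ h₁' h₂ h₂' c)
  rw [map_slantRight_assoc, slantRight_map, TensorProduct.map_map] at h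
  exact h

theorem comul_dropLeft {δ δ₁ δ₂ : G} (α β γ : G) (h₁ : δ = δ₁ * γ) (h₁' : δ₁ = α * β)
    (h₂ : δ = α * δ₂) (h₂' : δ₂ = β * γ) (c : Cc.C δ) :
    Cc.Δ β γ h₂' (Cc.dropLeft u α δ₂ h₂ c) =
      TensorProduct.map (Cc.dropLeft u α β h₁') LinearMap.id (Cc.Δ δ₁ γ h₁ c) := by
  have h := congrArg (slantLeft (u α)) (Cc.coassoc_apply α β γ h₁ h₁' h₂ h₂' c)
  rw [slantLeft_assoc, slantLeft_map, TensorProduct.map_map] at h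
  exact h.symm

theorem map_dropRight_comul {δ δ₁ δ₂ : G} (α β γ : G) (h₁ : δ = δ₁ * γ) (h₁' : δ₁ = α * β)
    (h₂ : δ = α * δ₂) (h₂' : δ₂ = β * γ) (c : Cc.C δ) :
    TensorProduct.map (Cc.dropRight u α β h₁') LinearMap.id (Cc.Δ δ₁ γ h₁ c) =
      TensorProduct.map LinearMap.id (Cc.dropLeft u β γ h₂') (Cc.Δ α δ₂ h₂ c) := by
  have h := congrArg (TensorProduct.map LinearMap.id (slantLeft (u β)))
    (Cc.coassoc_apply α β γ h₁ h₁' h₂ h₂' c)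
  rw [map_slantLeft_assoc, TensorProduct.map_map, TensorProduct.map_map] at h
  exact h

theorem dropLeft_dropRight {δ δ₁ δ₂ : G} (α β γ : G) (h₁ : δ = δ₁ * γ) (h₁' : δ₁ = α * β)
    (h₂ : δ = α * δ₂) (h₂' : δ₂ = β * γ) (c : Cc.C δ) :
    Cc.dropLeft u α β h₁' (Cc.dropRight u δ₁ γ h₁ c) =
      Cc.dropRight u β γ h₂' (Cc.dropLeft u α δ₂ h₂ c) := by
  rw [dropLeft, LinearMap.comp_apply, Cc.comul_dropRight u α β γ h₁ h₁' h₂ h₂',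
    slantLeft_map]
  rfl

namespace IsCharacter

variable {Cc u}

theorem apply_dropRight (hu : Cc.IsCharacter u) {γ : G} (α β : G) (h : γ = α * β) (c : Cc.C γ) :
    u α (Cc.dropRight u α β h c) = u γ c := by
  rw [← hu.mul α β h]
  exact apply_slantRight _ _ _

theorem apply_dropLeft (hu : Cc.IsCharacter u) {γ : G} (α β : G) (h : γ = α * β) (c : Cc.C γ) :
    u β (Cc.dropLeft u α β h c) = u γ c := by
  rw [← hu.mul α β h]
  exact apply_slantLeft _ _ _

theorem dropRight_dropRight (hu : Cc.IsCharacter u) {δ δ₁ δ₂ : G} (α β γ : G)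
    (h₁ : δ = δ₁ * γ) (h₁' : δ₁ = α * β)
    (h₂ : δ = α * δ₂) (h₂' : δ₂ = β * γ) (c : Cc.C δ) :
    Cc.dropRight u α β h₁' (Cc.dropRight u δ₁ γ h₁ c) = Cc.dropRight u α δ₂ h₂ c := by
  have h : u β ∘ₗ Cc.dropRight u β γ h₂' = u δ₂ :=
    LinearMap.ext (hu.apply_dropRight β γ h₂')
  rw [dropRight, LinearMap.comp_apply, Cc.comul_dropRight u α β γ h₁ h₁' h₂ h₂',
    slantRight_map, h]
  rfl

theorem dropLeft_dropLeft (hu : Cc.IsCharacter u) {δ δ₁ δ₂ : G} (α β γ : G)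
    (h₁ : δ = δ₁ * γ) (h₁' : δ₁ = α * β)
    (h₂ : δ = α * δ₂) (h₂' : δ₂ = β * γ) (c : Cc.C δ) :
    Cc.dropLeft u β γ h₂' (Cc.dropLeft u α δ₂ h₂ c) = Cc.dropLeft u δ₁ γ h₁ c := by
  have h : u β ∘ₗ Cc.dropLeft u α β h₁' = u δ₁ :=
    LinearMap.ext (hu.apply_dropLeft α β h₁')
  rw [dropLeft, LinearMap.comp_apply, Cc.comul_dropLeft u α β γ h₁ h₁' h₂ h₂',
    slantLeft_map, h]
  rfl

theorem dropRight_one (hu : Cc.IsCharacter u) (α : G) (h : α = α * 1) (c : Cc.C α) :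
    Cc.dropRight u α 1 h c = c := by
  rw [dropRight, hu.one]
  exact LinearMap.congr_fun (Cc.counit_right α h) c

theorem dropLeft_one (hu : Cc.IsCharacter u) (α : G) (h : α = 1 * α) (c : Cc.C α) :
    Cc.dropLeft u 1 α h c = c := by
  rw [dropLeft, hu.one]
  exact LinearMap.congr_fun (Cc.counit_left α h) c

theorem dropRight_dropRight_cancel (hu : Cc.IsCharacter u) {γ : G} (α β β' : G)
    (h : γ = α * β) (h' : α = γ * β')
    (c : Cc.C γ) : Cc.dropRight u γ β' h' (Cc.dropRight u α β h c) = c := by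
  have hβ : β' * β = 1 := by
    have : γ * (β' * β) = γ := by rw [← mul_assoc, ← h', ← h]
    simpa using this
  rw [hu.dropRight_dropRight γ β' β h h' (mul_one γ).symm hβ.symm, hu.dropRight_one]

/-- The isomorphism `C_α ≃ C_e`, `c ↦ c_{(1,e)} u_α(c_{(2,α)})`. -/
noncomputable def equivOne (hu : Cc.IsCharacter u) (α : G) : Cc.C α ≃ₗ[k] Cc.C 1 :=
  LinearEquiv.ofLinearMap (Cc.dropRight u 1 α (one_mul α).symm)
    (Cc.dropRight u α α⁻¹ (mul_inv_cancel α).symm)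
    (LinearMap.ext fun c => hu.dropRight_dropRight_cancel _ _ _ _ _ c)
    (LinearMap.ext fun c => hu.dropRight_dropRight_cancel _ _ _ _ _ c)

end IsCharacter

/-- The action of `α` on `C_e`: `c ↦ u_α(c_{(1,α)}) c_{(2,e)} u_{α⁻¹}(c_{(3,α⁻¹)})`. -/
noncomputable def conj (α : G) : Cc.C 1 →ₗ[k] Cc.C 1 :=
  Cc.dropRight u 1 α⁻¹ (one_mul α⁻¹).symm ∘ₗ Cc.dropLeft u α α⁻¹ (mul_inv_cancel α).symm

namespace IsCharacter

variable {Cc u}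

theorem conj_one (hu : Cc.IsCharacter u) : Cc.conj u 1 = LinearMap.id := by
  ext c
  have key : ∀ (g : G) (_ : g = 1) (h₁ : g = 1 * g) (h₂ : (1 : G) = 1 * g),
      Cc.dropRight u 1 g h₁ (Cc.dropLeft u 1 g h₂ c) = c := by
    rintro _ rfl h₁ h₂
    rw [hu.dropLeft_one, hu.dropRight_one]
  exact key _ inv_one _ _

theorem conj_mul (hu : Cc.IsCharacter u) (α β : G) :
    Cc.conj u (α * β) = Cc.conj u β ∘ₗ Cc.conj u α := by
  ext c
  simp only [conj, LinearMap.comp_apply]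
  rw [Cc.dropLeft_dropRight u β β⁻¹ α⁻¹ (δ₂ := (α * β)⁻¹) (one_mul _).symm
      (mul_inv_cancel β).symm (by group) (by group),
    hu.dropLeft_dropLeft α β (α * β)⁻¹ (by group) rfl,
    hu.dropRight_dropRight 1 β⁻¹ α⁻¹ _ _ (one_mul _).symm (by group)]

theorem counit_conj (hu : Cc.IsCharacter u) (α : G) (c : Cc.C 1) :
    Cc.ε (Cc.conj u α c) = Cc.ε c := by
  rw [← hu.one, conj, LinearMap.comp_apply, hu.apply_dropRight, hu.apply_dropLeft]

/-- In `C_{αβ}`, translating to `C_e` and acting by `α` amounts to dropping `α` on the left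
and `β` on the right. -/
theorem conj_dropRight (hu : Cc.IsCharacter u) {γ : G} (α β : G) (h : γ = α * β) (c : Cc.C γ) :
    Cc.conj u α (Cc.dropRight u 1 γ (one_mul γ).symm c) =
      Cc.dropRight u 1 β (one_mul β).symm (Cc.dropLeft u α β h c) := by
  rw [conj, LinearMap.comp_apply, Cc.dropLeft_dropRight u α α⁻¹ γ _ _ h (by simp [h]),
    hu.dropRight_dropRight 1 α⁻¹ γ (δ₂ := β) _ _ _ (by simp [h])]

theorem comul_dropRight_one (hu : Cc.IsCharacter u) {γ : G} (α β : G) (h : γ = α * β) (c : Cc.C γ) :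
    TensorProduct.map (Cc.dropRight u 1 α (one_mul α).symm)
        (Cc.dropRight u 1 β (one_mul β).symm) (Cc.Δ α β h c) =
      TensorProduct.map LinearMap.id (Cc.conj u α)
        (Cc.Δ 1 1 (one_mul 1).symm (Cc.dropRight u 1 γ (one_mul γ).symm c)) := by
  have hc : Cc.conj u α ∘ₗ Cc.dropRight u 1 γ (one_mul γ).symm =
      Cc.dropRight u 1 β (one_mul β).symm ∘ₗ Cc.dropLeft u α β h :=
    LinearMap.ext (hu.conj_dropRight α β h)
  rw [Cc.comul_dropRight u 1 1 γ _ _ (one_mul γ).symm (one_mul γ).symm,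
    TensorProduct.map_map, hc,
    ← TensorProduct.map_map, ← Cc.map_dropRight_comul u 1 α β h (one_mul α).symm,
    TensorProduct.map_map]
  rfl

theorem comul_conj (hu : Cc.IsCharacter u) (α : G) (c : Cc.C 1) :
    Cc.Δ 1 1 (one_mul 1).symm (Cc.conj u α c) =
      TensorProduct.map (Cc.conj u α) (Cc.conj u α) (Cc.Δ 1 1 (one_mul 1).symm c) := by
  have hα : (1 : G) = α * α⁻¹ := (mul_inv_cancel α).symm
  have hc : Cc.conj u α ∘ₗ Cc.dropRight u 1 α (one_mul α).symm =
      Cc.dropLeft u α 1 (mul_one α).symm := by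
    ext x
    rw [LinearMap.comp_apply, hu.conj_dropRight α 1 (mul_one α).symm, hu.dropRight_one]
  have h := congrArg (TensorProduct.map (Cc.conj u α) LinearMap.id)
    (hu.comul_dropRight_one α α⁻¹ hα c)
  rw [hu.dropRight_one, TensorProduct.map_map,
    TensorProduct.map_map, hc] at h
  simp only [LinearMap.id_comp, LinearMap.comp_id] at h
  rw [← h, conj, LinearMap.comp_apply,
    Cc.comul_dropRight u 1 1 α⁻¹ _ _ (one_mul _).symm (one_mul _).symm,
    Cc.comul_dropLeft u α 1 α⁻¹ hα (mul_one α).symm,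
    TensorProduct.map_map]
  rfl

end IsCharacter

/-- The coalgebra structure on the component `C_e`. -/
noncomputable abbrev coalgebraOne : Coalgebra k (Cc.C 1) where
  comul := Cc.Δ 1 1 (one_mul 1).symm
  counit := Cc.ε
  coassoc := Cc.coassoc 1 1 1 _ _ _ _
  rTensor_counit_comp_comul := by
    ext c
    apply (TensorProduct.lid k (Cc.C 1)).injective
    simpa [LinearMap.rTensor] using LinearMap.congr_fun (Cc.counit_left 1 (one_mul 1).symm) c
  lTensor_counit_comp_comul := by
    ext c
    apply (TensorProduct.rid k (Cc.C 1)).injective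
    simpa [LinearMap.lTensor] using LinearMap.congr_fun (Cc.counit_right 1 (one_mul 1).symm) c

/-- The smash coproduct data on `C_e` attached to a morphism to `k⟨G⟩`. -/
noncomputable def IsCharacter.smashData {Cc : GCoalgebra k G} {u : ∀ α : G, Cc.C α →ₗ[k] k}
    (hu : Cc.IsCharacter u) : CrossedData k G :=
  letI := Cc.coalgebraOne
  { C := Cc.C 1
    lam := fun α =>
      { Cc.conj u α with
        counit_comp := LinearMap.ext (hu.counit_conj α)
        map_comp_comul := LinearMap.ext fun c => (hu.comul_conj α c).symm }
    f := fun _ _ => Cc.ε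
    g := fun _ _ => Cc.ε }

end GCoalgebra

theorem convMF_counit {k C : Type u} [Field k] [AddCommGroup C] [Module k C] [Coalgebra k C]
    (T : C →ₗ[k] C) : convMF k C T Coalgebra.counit = T := by
  ext c
  have h : TensorProduct.map T Coalgebra.counit (Coalgebra.comul c) =
      TensorProduct.map T LinearMap.id
        (Coalgebra.counit.lTensor C (Coalgebra.comul (R := k) c)) := by
    rw [LinearMap.lTensor, TensorProduct.map_map, LinearMap.comp_id, LinearMap.id_comp]
  rw [Coalgebra.lTensor_counit_comul] at h
  simp [convMF, h]

theorem CrossedData.delta_of_eq_counit {k G : Type u} [Field k] [Group G] (D : CrossedData k G)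
    {α β : G} (hf : D.f α β = Coalgebra.counit) :
    D.delta α β = TensorProduct.map LinearMap.id (D.lam α).toLinearMap ∘ₗ Coalgebra.comul := by
  rw [CrossedData.delta, hf, convMF_counit]

/-- The counits of the components of a smash coproduct are multiplicative. -/
theorem CrossedData.mul_counit_comp_delta {k G : Type u} [Field k] [Group G]
    (D : CrossedData k G) {α β : G} (hf : D.f α β = Coalgebra.counit) :
    LinearMap.mul' k k ∘ₗ TensorProduct.map Coalgebra.counit Coalgebra.counit ∘ₗ D.delta α β =
      Coalgebra.counit := by
  rw [D.delta_of_eq_counit hf]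
  ext c
  have h : TensorProduct.map Coalgebra.counit Coalgebra.counit (Coalgebra.comul c) =
      TensorProduct.map LinearMap.id Coalgebra.counit
        (Coalgebra.counit.rTensor D.C (Coalgebra.comul (R := k) c)) := by
    rw [LinearMap.rTensor, TensorProduct.map_map, LinearMap.comp_id, LinearMap.id_comp]
  rw [Coalgebra.rTensor_counit_comul] at h
  simp [TensorProduct.map_map, h]

/-- **Theorem 3.5.** For a `G`-coalgebra `C̲` the following are equivalent:
(1) `C̲` is isomorphic to a smash coproduct `G`-coalgebra, i.e. a crossed coproduct
with trivial factor set `f_{α,β} = ε_C` and `λ` a genuine `G`-action;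
(2) there is a morphism of `G`-coalgebras `u̲ : C̲ → k⟨G⟩`, i.e. a family of
functionals `u_α ∈ C_α*` with `u_e = ε` and `u_α(c_{(1,α)}) u_β(c_{(2,β)}) = u_{αβ}(c)`. -/
theorem iso_smash_iff_morphism_to_kG {k G : Type u} [Field k] [Group G]
    (Cc : GCoalgebra k G) :
    (∃ D : CrossedData k G,
      (∀ α β : G, D.f α β = Coalgebra.counit) ∧
      (∀ α β : G, D.g α β = Coalgebra.counit) ∧
      ((D.lam 1).toLinearMap = LinearMap.id) ∧
      (∀ α β : G, (D.lam (α * β)).toLinearMap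
        = (D.lam β).toLinearMap ∘ₗ (D.lam α).toLinearMap) ∧
      IsoToCrossed Cc D)
    ↔ (∃ u : ∀ α : G, Cc.C α →ₗ[k] k,
        u 1 = Cc.ε ∧
        ∀ ⦃γ : G⦄ (α β : G) (h : γ = α * β),
          LinearMap.mul' k k ∘ₗ TensorProduct.map (u α) (u β) ∘ₗ Cc.Δ α β h = u γ) := by
  constructor
  · rintro ⟨D, hf, hg, -, -, φ, hφ, hΔ⟩
    refine ⟨fun α => Coalgebra.counit ∘ₗ (φ α).toLinearMap, by rw [← hφ, hg], ?_⟩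
    intro γ α β h
    rw [TensorProduct.map_comp, LinearMap.comp_assoc, hΔ α β h]
    exact congrArg (· ∘ₗ (φ γ).toLinearMap) (D.mul_counit_comp_delta (hf α β))
  · rintro ⟨u, hu₁, hu₂⟩
    have hu : Cc.IsCharacter u := ⟨hu₁, hu₂⟩
    refine ⟨hu.smashData, fun _ _ => rfl, fun _ _ => rfl, hu.conj_one, hu.conj_mul,
      hu.equivOne, ?_, ?_⟩
    · ext c
      exact congrArg Cc.ε (hu.dropRight_one 1 _ c)
    · intro γ α β h
      rw [hu.smashData.delta_of_eq_counit rfl]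
      exact LinearMap.ext (hu.comul_dropRight_one α β h)
end
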